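/- Let G be a finite group. If a virtual representation x ∈ R(G) restricts to zero in R(H) for every hyperelementary subgroup H ≤ G, then x = 0; moreover R(G) is the inverse limit over the orbit category of hyperelementary subgroups of the rings R(H). -/

import Mathlib

/-- The representation ring `R(G)`: the subring of functions `G → ℂ` generated by the
characters of finite-dimensional complex representations of `G`. -/
noncomputable def repRing (G : Type) [Group G] : Subring (G → ℂ) :=
  Subring.closure {f | ∃ V : FDRep ℂ G, f = V.character}

/-- A finite group is hyperelementary if it is an extension of a cyclic group by a
`p`-group for some prime `p`: it has a normal cyclic subgroup with quotient a `p`-group. -/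
def IsHyperelementary (H : Type) [Group H] : Prop :=
  ∃ p : ℕ, p.Prime ∧ ∃ N : Subgroup H, ∃ hN : N.Normal,
    IsCyclic ↥N ∧ (letI := hN; IsPGroup p (H ⧸ N))

theorem character_mem_repRing {G : Type} [Group G] {V : Type} [AddCommGroup V] [Module ℂ V]
    [FiniteDimensional ℂ V] (ρ : Representation ℂ G V) : ρ.character ∈ repRing G :=
  Subring.subset_closure ⟨FDRep.of ρ, rfl⟩

/-- The characters of a group form a multiplicative monoid of functions. -/
def characterSubmonoid (G : Type) [Group G] : Submonoid (G → ℂ) where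
  carrier := {f | ∃ V : FDRep ℂ G, f = V.character}
  one_mem' := ⟨FDRep.of (Representation.trivial ℂ G ℂ), by
    ext g
    change (1 : ℂ) = LinearMap.trace ℂ ℂ (Representation.trivial ℂ G ℂ g)
    simp [Representation.trivial]⟩
  mul_mem' := by
    rintro _ _ ⟨V, rfl⟩ ⟨W, rfl⟩
    exact ⟨FDRep.of (Representation.tprod V.ρ W.ρ), (Representation.char_tensor V.ρ W.ρ).symm⟩

theorem repRing_induction {G : Type} [Group G] {P : (G → ℂ) → Prop}
    (char : ∀ V : FDRep ℂ G, P V.character) (zero : P 0) (add : ∀ a b, P a → P b → P (a + b))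
    (neg : ∀ a, P a → P (-a)) {f : G → ℂ} (hf : f ∈ repRing G) : P f := by
  have hf' : f ∈ AddSubgroup.closure (characterSubmonoid G : Set (G → ℂ)) := by
    rw [← (characterSubmonoid G).closure_eq]
    exact Subring.mem_closure_iff.1 hf
  clear hf
  induction hf' using AddSubgroup.closure_induction with
  | mem x hx =>
    obtain ⟨V, hV⟩ := hx
    rw [hV]
    exact char V
  | zero => exact zero
  | add a b _ _ ha hb => exact add a b ha hb
  | neg a _ ha => exact neg a ha

theorem repRing_conj {G : Type} [Group G] {f : G → ℂ} (hf : f ∈ repRing G) (g h : G) :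
    f (g * h * g⁻¹) = f h := by
  induction hf using Subring.closure_induction with
  | mem x hx => obtain ⟨V, rfl⟩ := hx; exact Representation.char_conj V.ρ h g
  | zero => rfl
  | one => rfl
  | add a b _ _ ha hb => simp [ha, hb]
  | neg a _ ha => simp [ha]
  | mul a b _ _ ha hb => simp [ha, hb]

theorem repRing_restrict {G : Type} [Group G] {f : G → ℂ} (hf : f ∈ repRing G)
    (H : Subgroup G) : f ∘ ((↑) : H → G) ∈ repRing H := by
  induction hf using Subring.closure_induction with
  | mem x hx =>
    obtain ⟨V, rfl⟩ := hx
    exact character_mem_repRing (V.ρ.comp H.subtype)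
  | zero => exact zero_mem _
  | one => exact one_mem _
  | add a b _ _ ha hb => exact add_mem ha hb
  | neg a _ ha => exact neg_mem ha
  | mul a b _ _ ha hb => exact mul_mem ha hb

theorem LinearMap.trace_pi_eq_sum {R ι V : Type*} [Field R] [Fintype ι] [DecidableEq ι]
    [AddCommGroup V] [Module R V] [FiniteDimensional R V] (f : (ι → V) →ₗ[R] (ι → V)) :
    LinearMap.trace R (ι → V) f =
      ∑ i, LinearMap.trace R V
        (LinearMap.proj i ∘ₗ f ∘ₗ LinearMap.single R (fun _ : ι => V) i) := by
  have h : f = ∑ i, (f ∘ₗ LinearMap.single R (fun _ : ι => V) i) ∘ₗ LinearMap.proj i := by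
    ext i v j
    simp [Pi.single_apply, apply_ite, ite_apply]
  conv_lhs => rw [h]
  rw [map_sum]
  exact Finset.sum_congr rfl fun i _ => LinearMap.trace_comp_comm' _ _

section Induction

variable {G : Type} [Group G] (H : Subgroup G)

/-- The representation of `H` on functions `G → V` whose invariants are the `H`-equivariant
functions, which form the representation induced from `V`. -/
def equivariantRep {V : Type} [AddCommGroup V] [Module ℂ V] (ρ : Representation ℂ H V) :
    Representation ℂ H (G → V) where
  toFun h :=
    { toFun f x := ρ h (f ((h : G)⁻¹ * x))
      map_add' _ _ := by ext; simp
      map_smul' _ _ := by ext; simp }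
  map_one' := by ext; simp
  map_mul' _ _ := by ext; simp [mul_assoc]

/-- Right translation on functions `G → V`. -/
def translationRep (G : Type) [Group G] (V : Type) [AddCommGroup V] [Module ℂ V] :
    Representation ℂ G (G → V) where
  toFun g := LinearMap.funLeft ℂ V (· * g)
  map_one' := by ext; simp [LinearMap.funLeft]
  map_mul' _ _ := by ext; simp [LinearMap.funLeft, mul_assoc]

theorem translationRep_mem_invariants {V : Type} [AddCommGroup V] [Module ℂ V]
    (ρ : Representation ℂ H V) (g : G) (f : G → V) (hf : f ∈ (equivariantRep H ρ).invariants) :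
    translationRep G V g f ∈ (equivariantRep H ρ).invariants := by
  intro h
  ext x
  simpa [equivariantRep, translationRep, LinearMap.funLeft, mul_assoc] using
    congrFun (hf h) (x * g)

/-- The representation of `G` induced from a representation of `H`. -/
noncomputable def inducedRep {V : Type} [AddCommGroup V] [Module ℂ V] (ρ : Representation ℂ H V) :
    Representation ℂ G (equivariantRep H ρ).invariants where
  toFun g := (translationRep G V g).restrict (translationRep_mem_invariants H ρ g)
  map_one' := by ext; simp
  map_mul' _ _ := by ext; simp

variable [Fintype G]

open Classical in
/-- The function on `G` induced from a function on the subgroup `H`. -/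
noncomputable def inducedFunction (ψ : H → ℂ) (g : G) : ℂ :=
  (Nat.card H : ℂ)⁻¹ * ∑ h : H, ∑ x : G, if x * g * x⁻¹ = h then ψ h else 0

theorem inducedRep_character {V : Type} [AddCommGroup V] [Module ℂ V] [FiniteDimensional ℂ V]
    (ρ : Representation ℂ H V) : (inducedRep H ρ).character = inducedFunction H ρ.character := by
  classical
  ext g
  have : Invertible (Nat.card H : ℂ) := invertibleOfNonzero (by simp)
  have : Invertible (Fintype.card H : ℂ) := invertibleOfNonzero (by simp)
  have hmem : ∀ f, (translationRep G V g ∘ₗ (equivariantRep H ρ).averageMap) f ∈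
      (equivariantRep H ρ).invariants := fun f =>
    translationRep_mem_invariants H ρ g _ (Representation.averageMap_invariant _ f)
  have hres : (inducedRep H ρ) g =
      (translationRep G V g ∘ₗ (equivariantRep H ρ).averageMap).restrict fun f _ => hmem f := by
    ext1 f
    apply Subtype.ext
    exact congrArg (translationRep G V g) (Representation.averageMap_id _ _ f.2).symm
  rw [Representation.character, hres, LinearMap.trace_restrict_eq_of_forall_mem _ _ hmem]
  have havg : translationRep G V g ∘ₗ (equivariantRep H ρ).averageMap =
      (Nat.card H : ℂ)⁻¹ • ∑ h : H, translationRep G V g ∘ₗ equivariantRep H ρ h := by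
    refine LinearMap.ext fun f => ?_
    simp [Representation.averageMap, GroupAlgebra.average, LinearMap.sum_apply]
  have hblock : ∀ (h : H) (x : G), LinearMap.trace ℂ V (LinearMap.proj x ∘ₗ
      (translationRep G V g ∘ₗ equivariantRep H ρ h) ∘ₗ
        LinearMap.single ℂ (fun _ : G => V) x) =
      if x * g * x⁻¹ = h then ρ.character h else 0 := by
    intro h x
    have hiff : (h : G)⁻¹ * (x * g) = x ↔ x * g * x⁻¹ = h := by
      rw [inv_mul_eq_iff_eq_mul, mul_inv_eq_iff_eq_mul]
    split_ifs with hx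
    · refine congrArg _ (LinearMap.ext fun v => ?_)
      simp [translationRep, equivariantRep, LinearMap.funLeft, hiff.2 hx]
    · rw [← map_zero (LinearMap.trace ℂ V)]
      refine congrArg _ (LinearMap.ext fun v => ?_)
      simp [translationRep, equivariantRep, LinearMap.funLeft,
        Pi.single_eq_of_ne (hiff.not.2 hx)]
  rw [havg, map_smul, map_sum, smul_eq_mul, inducedFunction]
  simp only [LinearMap.trace_pi_eq_sum, hblock]

theorem inducedFunction_mem_repRing {ψ : H → ℂ} (hψ : ψ ∈ repRing H) :
    inducedFunction H ψ ∈ repRing G := by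
  refine repRing_induction (P := fun ψ => inducedFunction H ψ ∈ repRing G)
    (fun V => ?_) ?_ (fun a b ha hb => ?_) (fun a ha => ?_) hψ
  · change inducedFunction H (Representation.character V.ρ) ∈ repRing G
    rw [← inducedRep_character]
    exact character_mem_repRing _
  · convert zero_mem (repRing G)
    ext g
    simp [inducedFunction]
  · convert add_mem ha hb using 1
    ext g
    simp only [inducedFunction, Pi.add_apply, ← mul_add, ← Finset.sum_add_distrib, ← ite_add_zero]
  · convert neg_mem ha using 1
    ext g
    simp only [inducedFunction, Pi.neg_apply, ← mul_neg, ← Finset.sum_neg_distrib, neg_ite,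
      neg_zero]

/-- The permutation character of `G` on the cosets of `H`. -/
noncomputable def cosetCharacter (g : G) : ℤ := Nat.card (MulAction.fixedBy (G ⧸ H) g)

omit [Fintype G] in
theorem card_fixedBy_mul_card (g : G) :
    Nat.card (MulAction.fixedBy (G ⧸ H) g) * Nat.card H =
      Nat.card {x : G // x⁻¹ * g * x ∈ H} := by
  rw [mul_comm, ← Nat.card_prod, ← Nat.card_congr (QuotientGroup.preimageMkEquivSubgroupProdSet _ _)]
  refine Nat.card_congr (Equiv.subtypeEquivRight fun x => ?_)
  rw [Set.mem_preimage, MulAction.mem_fixedBy, eq_comm, MulAction.Quotient.smul_mk,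
    QuotientGroup.eq, smul_eq_mul, mul_assoc]

theorem inducedFunction_restrict {φ : G → ℂ} (hφ : ∀ g h, φ (g * h * g⁻¹) = φ h) :
    inducedFunction H (φ ∘ (↑)) = fun g => (cosetCharacter H g : ℂ) * φ g := by
  classical
  ext g
  have h1 : ∀ x : G, (∑ h : H, if x * g * x⁻¹ = h then φ h else 0) =
      if x * g * x⁻¹ ∈ H then φ g else 0 := by
    intro x
    split_ifs with hx
    · rw [Finset.sum_eq_single ⟨_, hx⟩]
      · simp [hφ]
      · intro b _ hb
        rw [if_neg]
        rintro h
        exact hb (Subtype.ext h.symm)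
      · simp
    · refine Finset.sum_eq_zero fun h _ => if_neg ?_
      intro h'
      exact hx (h' ▸ h.2)
  have h2 : (Nat.card {x : G // x⁻¹ * g * x ∈ H}) = Nat.card {x : G // x * g * x⁻¹ ∈ H} :=
    Nat.card_congr ((Equiv.inv G).subtypeEquiv fun x => by simp)
  have h3 := card_fixedBy_mul_card H g
  rw [h2, Nat.card_eq_fintype_card (α := {x : G // x * g * x⁻¹ ∈ H}), Fintype.card_subtype] at h3
  have h4 : (Nat.card H : ℂ) ≠ 0 := by simp
  simp only [inducedFunction, Function.comp_apply]
  rw [Finset.sum_comm]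
  simp only [h1]
  rw [← Finset.sum_filter, Finset.sum_const, nsmul_eq_mul, ← h3, cosetCharacter]
  push_cast
  field_simp

end Induction

theorem isHyperelementary_of_isCyclic (H : Type) [Group H] [IsCyclic H] : IsHyperelementary H := by
  refine ⟨2, Nat.prime_two, ⊤, inferInstance, inferInstance, fun x => ⟨0, ?_⟩⟩
  exact (QuotientGroup.subsingleton_quotient_top (G := H)).elim _ _

theorem card_fixedBy_pow_modEq {G X : Type*} [Group G] [MulAction G X] [Finite X] {p : ℕ}
    (hp : p.Prime) (g : G) (n : ℕ) :
    Nat.card (MulAction.fixedBy X (g ^ p ^ n)) ≡ Nat.card (MulAction.fixedBy X g) [MOD p] := by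
  classical
  have := Fact.mk hp
  have := Fintype.ofFinite (MulAction.fixedBy X (g ^ p ^ n))
  let f : Function.End (MulAction.fixedBy X (g ^ p ^ n)) := fun q => ⟨g • q.1, by
    have hq := q.2
    rw [MulAction.mem_fixedBy] at hq ⊢
    rw [smul_smul, ← pow_succ, pow_succ', mul_smul, hq]⟩
  have hf : ∀ (m : ℕ) q, ((f ^ m) q).1 = g ^ m • q.1 := by
    intro m
    induction m with
    | zero =>
      intro q
      rw [pow_zero, pow_zero, one_smul]
      rfl
    | succ m ih =>
      intro q
      rw [pow_succ, pow_succ, mul_smul]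
      exact ih (f q)
  have hf1 : f ^ p ^ n = 1 := by
    funext q
    exact Subtype.ext ((hf _ q).trans q.2)
  have hcard := Equiv.Perm.card_fixedPoints_modEq hf1
  rw [← Nat.card_eq_fintype_card, ← Nat.card_eq_fintype_card] at hcard
  have e : Function.fixedPoints f ≃ MulAction.fixedBy X g :=
    { toFun q := ⟨q.1.1, congrArg Subtype.val q.2⟩
      invFun q := ⟨⟨q.1, by
        have hq := q.2
        rw [MulAction.mem_fixedBy] at hq ⊢
        exact MulAction.mem_stabilizer_iff.1
          (pow_mem (MulAction.mem_stabilizer_iff.2 hq : g ∈ MulAction.stabilizer G q.1) _)⟩,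
        Subtype.ext q.2⟩
      left_inv _ := rfl
      right_inv _ := rfl }
  rwa [Nat.card_congr e] at hcard

theorem isHyperelementary_of_zpowers {G : Type} [Group G] {p : ℕ} (hp : p.Prime) {c : G} {H : Subgroup G}
    (hcH : H ≤ Subgroup.normalizer (Subgroup.zpowers c : Set G))
    (hH : ∀ y ∈ H, ∃ m : ℕ, y ^ p ^ m ∈ Subgroup.zpowers c) : IsHyperelementary H := by
  refine ⟨p, hp, (Subgroup.zpowers c).subgroupOf H,
    Subgroup.normal_subgroupOf_of_le_normalizer hcH, ?_, ?_⟩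
  · let f : (Subgroup.zpowers c).subgroupOf H →* Subgroup.zpowers c :=
      ((H.subtype.comp ((Subgroup.zpowers c).subgroupOf H).subtype).codRestrict _ fun x => x.2)
    refine isCyclic_of_injective f fun x y hxy => ?_
    exact Subtype.ext (Subtype.ext (congrArg (fun z : Subgroup.zpowers c => (z : G)) hxy))
  · have := Subgroup.normal_subgroupOf_of_le_normalizer hcH
    intro x
    obtain ⟨y, rfl⟩ := QuotientGroup.mk_surjective x
    obtain ⟨m, hm⟩ := hH y y.2
    refine ⟨m, ?_⟩
    rw [← QuotientGroup.mk_pow, QuotientGroup.eq_one_iff]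
    exact hm

theorem mem_normalizer_zpowers_of_conj_mem {G : Type} [Group G] [Finite G] {c x : G}
    (h : x⁻¹ * c * x ∈ Subgroup.zpowers c) :
    x ∈ Subgroup.normalizer (Subgroup.zpowers c : Set G) := by
  have hle : (Subgroup.zpowers c).map (MulAut.conj x⁻¹).toMonoidHom ≤ Subgroup.zpowers c := by
    rw [MonoidHom.map_zpowers, Subgroup.zpowers_le]
    simpa using h
  have heq := Subgroup.eq_of_le_of_card_ge hle
    (Subgroup.card_map_of_injective (MulAut.conj x⁻¹).injective).ge
  rw [← inv_mem_iff, Subgroup.mem_normalizer_iff_map_conj_eq]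
  exact heq

/-- If the order of `c` is prime to `p`, then the elements conjugating `c` into a group whose
`p`-power-th powers lie in `⟨c⟩` are those normalizing `⟨c⟩`. -/
theorem conj_mem_iff_mem_normalizer {G : Type} [Group G] [Finite G] {p : ℕ} {c : G} (hc : p.Coprime (orderOf c))
    {H : Subgroup G} (hcH : c ∈ H) (hH : ∀ y ∈ H, ∃ m : ℕ, y ^ p ^ m ∈ Subgroup.zpowers c)
    (x : G) : x⁻¹ * c * x ∈ H ↔ x ∈ Subgroup.normalizer (Subgroup.zpowers c : Set G) := by
  constructor
  · intro hx
    apply mem_normalizer_zpowers_of_conj_mem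
    obtain ⟨m, hm⟩ := hH _ hx
    have hord : orderOf (x⁻¹ * c * x) = orderOf c := by
      simpa using (MulAut.conj x⁻¹).orderOf_eq c
    obtain ⟨k, hk⟩ := exists_pow_eq_self_of_coprime (n := p ^ m) (x := x⁻¹ * c * x)
      (hord ▸ hc.pow_left m)
    rw [← hk]
    exact pow_mem hm k
  · intro hx
    have := (Subgroup.mem_normalizer_iff''.1 hx c).1 (Subgroup.mem_zpowers c)
    exact (Subgroup.zpowers_le.2 hcH) this

theorem exists_isHyperelementary_not_dvd_cosetCharacter {G : Type} [Group G] [Finite G] {p : ℕ} (hp : p.Prime)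
    (g : G) : ∃ H : Subgroup G, IsHyperelementary H ∧ ¬ (p : ℤ) ∣ cosetCharacter H g := by
  have := Fact.mk hp
  set n := (orderOf g).factorization p
  set c := g ^ p ^ n with hc
  have hcop : p.Coprime (orderOf c) := by
    rw [hc, orderOf_pow, Nat.gcd_eq_right (Nat.ordProj_dvd _ _)]
    exact Nat.coprime_ordCompl hp (orderOf_pos g).ne'
  set C := Subgroup.zpowers c
  set N := Subgroup.normalizer (C : Set G)
  have hCN : C ≤ N := Subgroup.le_normalizer
  have hnormal : (C.subgroupOf N).Normal := Subgroup.normal_in_normalizer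
  let Q : Sylow p (N ⧸ C.subgroupOf N) := default
  set K : Subgroup N := (Q : Subgroup _).comap (QuotientGroup.mk' (C.subgroupOf N))
  set H := K.map N.subtype
  have hHN : H ≤ N := Subgroup.map_subtype_le K
  have hcH : c ∈ H := by
    refine ⟨⟨c, hCN (Subgroup.mem_zpowers c)⟩, ?_, rfl⟩
    have : (QuotientGroup.mk' (C.subgroupOf N)) ⟨c, hCN (Subgroup.mem_zpowers c)⟩ = 1 :=
      (QuotientGroup.eq_one_iff _).2 (Subgroup.mem_zpowers c)
    exact Subgroup.mem_comap.2 (this ▸ one_mem _)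
  have hH : ∀ y ∈ H, ∃ m : ℕ, y ^ p ^ m ∈ C := by
    rintro _ ⟨y, hy, rfl⟩
    obtain ⟨m, hm⟩ := Q.isPGroup' ⟨_, hy⟩
    refine ⟨m, ?_⟩
    have h1 : (QuotientGroup.mk' (C.subgroupOf N)) (y ^ p ^ m) = 1 := by
      rw [map_pow]
      exact congrArg Subtype.val hm
    exact (QuotientGroup.eq_one_iff (y ^ p ^ m)).1 h1
  refine ⟨H, isHyperelementary_of_zpowers hp hHN hH, ?_⟩
  have hcount := card_fixedBy_mul_card H c
  rw [Nat.card_congr (Equiv.subtypeEquivRight (conj_mem_iff_mem_normalizer hcop hcH hH)),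
    Subgroup.card_map_of_injective N.subtype_injective] at hcount
  change _ = Nat.card N at hcount
  rw [← K.index_mul_card] at hcount
  have hfix := Nat.eq_of_mul_eq_mul_right Nat.card_pos hcount
  rw [Subgroup.index_comap_of_surjective _ (QuotientGroup.mk'_surjective _)] at hfix
  have hmod := card_fixedBy_pow_modEq (X := G ⧸ H) hp g n
  rw [cosetCharacter, Int.natCast_dvd_natCast, ← hmod.dvd_iff dvd_rfl, ← hc, hfix]
  exact Q.not_dvd_index

theorem NonUnitalSubring.one_mem_of_forall_prime {X : Type*} [Finite X]
    (J : NonUnitalSubring (X → ℤ))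
    (hJ : ∀ (x : X) (p : ℕ), p.Prime → ∃ a ∈ J, ¬ (p : ℤ) ∣ a x) : 1 ∈ J := by
  classical
  have := Fintype.ofFinite X
  have hx : ∀ x : X, ∃ a ∈ J, a x = 1 := by
    intro x
    obtain ⟨d, hd⟩ := Int.subgroup_cyclic
      (J.toAddSubgroup.map (Pi.evalAddMonoidHom (fun _ : X => ℤ) x))
    have hdvd : ∀ a ∈ J, d ∣ a x := by
      intro a ha
      have : a x ∈ J.toAddSubgroup.map (Pi.evalAddMonoidHom (fun _ : X => ℤ) x) := ⟨a, ha, rfl⟩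
      rw [hd, ← AddSubgroup.zmultiples_eq_closure] at this
      exact Int.mem_zmultiples_iff.1 this
    have hunit : d.natAbs = 1 := by
      by_contra hne
      obtain ⟨p, hp, hpd⟩ := Nat.exists_prime_and_dvd hne
      obtain ⟨a, ha, hpa⟩ := hJ x p hp
      exact hpa ((Int.natCast_dvd.2 hpd).trans (hdvd a ha))
    have h1 : (1 : ℤ) ∈ J.toAddSubgroup.map (Pi.evalAddMonoidHom (fun _ : X => ℤ) x) := by
      rw [hd, ← AddSubgroup.zmultiples_eq_closure, Int.mem_zmultiples_iff]
      exact (Int.isUnit_iff_natAbs_eq.2 hunit).dvd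
    obtain ⟨a, ha, h⟩ := h1
    exact ⟨a, ha, h⟩
  choose a haJ ha using hx
  have hprod : ∀ s : Finset X, 1 - ∏ x ∈ s, (1 - a x) ∈ J := by
    intro s
    induction s using Finset.induction_on with
    | empty => simp
    | insert x s hxs ih =>
      rw [Finset.prod_insert hxs]
      convert sub_mem (add_mem (haJ x) ih) (mul_mem (haJ x) ih) using 1
      ring
  convert hprod Finset.univ
  ext x
  simp only [Pi.sub_apply, Finset.prod_apply, Pi.one_apply]
  rw [Finset.prod_eq_zero (Finset.mem_univ x) (by simp [ha]), sub_zero]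

/-- The class functions whose restrictions to hyperelementary subgroups lie in the
representation rings. -/
def IsHyperelementaryLocal {G : Type} [Group G] (φ : G → ℂ) : Prop :=
  (∀ g h, φ (g * h * g⁻¹) = φ h) ∧
    ∀ H : Subgroup G, IsHyperelementary H → φ ∘ ((↑) : H → G) ∈ repRing H

theorem isHyperelementaryLocal_of_mem_repRing {G : Type} [Group G] {φ : G → ℂ}
    (hφ : φ ∈ repRing G) : IsHyperelementaryLocal φ :=
  ⟨repRing_conj hφ, fun H _ => repRing_restrict hφ H⟩

/-- The integer-valued functions which multiply every hyperelementary-local class function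
into the representation ring. -/
def repRingConductor (G : Type) [Group G] : NonUnitalSubring (G → ℤ) where
  carrier := {a | ∀ φ : G → ℂ, IsHyperelementaryLocal φ → (fun g => (a g : ℂ) * φ g) ∈ repRing G}
  zero_mem' φ _ := by
    convert zero_mem (repRing G) using 1
    ext g
    simp
  add_mem' {a b} ha hb φ hφ := by
    convert add_mem (ha φ hφ) (hb φ hφ) using 1
    ext g
    simp [add_mul]
  neg_mem' {a} ha φ hφ := by
    convert neg_mem (ha φ hφ) using 1
    ext g
    simp
  mul_mem' {a b} ha hb φ hφ := by
    convert ha _ (isHyperelementaryLocal_of_mem_repRing (hb φ hφ)) using 1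
    ext g
    simp [mul_assoc]

theorem IsHyperelementaryLocal.mem_repRing {G : Type} [Group G] [Fintype G] {φ : G → ℂ}
    (hφ : IsHyperelementaryLocal φ) : φ ∈ repRing G := by
  have h1 : 1 ∈ repRingConductor G := by
    refine NonUnitalSubring.one_mem_of_forall_prime _ fun g p hp => ?_
    obtain ⟨H, hH, hpH⟩ := exists_isHyperelementary_not_dvd_cosetCharacter hp g
    refine ⟨cosetCharacter H, fun ψ hψ => ?_, hpH⟩
    rw [← inducedFunction_restrict H hψ.1]
    exact inducedFunction_mem_repRing H (hψ.2 H hH)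
  simpa using h1 φ hφ

/-- Hyperelementary induction for representation rings of finite groups: a virtual
representation restricting to zero on every hyperelementary subgroup is zero; moreover
`R(G)` is the inverse limit, over the orbit category of hyperelementary subgroups, of the
rings `R(H)`: the restriction maps give a bijection from `R(G)` onto the set of families
`(F_H ∈ R(H))_H` compatible under subconjugation. -/
theorem repRing_hyperelementary_induction (G : Type) [Group G] [Fintype G] :
    (∀ x : ↥(repRing G),
        (∀ H : Subgroup G, IsHyperelementary ↥H → ∀ h : ↥H, (x : G → ℂ) (h : G) = 0) → x = 0) ∧
      Function.Injective
        (fun (x : ↥(repRing G)) (H : {H : Subgroup G // IsHyperelementary ↥H}) =>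
          (x : G → ℂ) ∘ ((↑) : ↥H.val → G)) ∧
      {F : ∀ H : {H : Subgroup G // IsHyperelementary ↥H}, ↥H.val → ℂ |
          (∀ H : {H : Subgroup G // IsHyperelementary ↥H}, F H ∈ repRing ↥H.val) ∧
          ∀ (H K : {H : Subgroup G // IsHyperelementary ↥H}) (g : G)
            (h : G) (hh : h ∈ H.val) (hk : g * h * g⁻¹ ∈ K.val),
              F H ⟨h, hh⟩ = F K ⟨g * h * g⁻¹, hk⟩} =
        Set.range (fun (x : ↥(repRing G)) (H : {H : Subgroup G // IsHyperelementary ↥H}) =>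
          (x : G → ℂ) ∘ ((↑) : ↥H.val → G)) := by
  have hzpow : ∀ g : G, IsHyperelementary (Subgroup.zpowers g) := fun g =>
    isHyperelementary_of_isCyclic _
  refine ⟨fun x hx => ?_, fun x y hxy => ?_, Set.Subset.antisymm ?_ ?_⟩
  · ext g
    exact hx _ (hzpow g) ⟨g, Subgroup.mem_zpowers g⟩
  · ext g
    exact congrFun (congrFun hxy ⟨_, hzpow g⟩) ⟨g, Subgroup.mem_zpowers g⟩
  · rintro F ⟨hF, hcompat⟩
    let φ : G → ℂ := fun g => F ⟨_, hzpow g⟩ ⟨g, Subgroup.mem_zpowers g⟩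
    have hres : ∀ H : {H : Subgroup G // IsHyperelementary H}, φ ∘ ((↑) : H.val → G) = F H := by
      intro H
      ext h
      have hh : 1 * (h : G) * 1⁻¹ = h := by simp
      refine (hcompat ⟨_, hzpow h⟩ H 1 h (Subgroup.mem_zpowers _) (hh.symm ▸ h.2)).trans ?_
      exact congrArg (F H) (Subtype.ext hh)
    have hφ : IsHyperelementaryLocal φ := by
      refine ⟨fun g h => ?_, fun H hH => ?_⟩
      · exact (hcompat ⟨_, hzpow h⟩ ⟨_, hzpow (g * h * g⁻¹)⟩ g h (Subgroup.mem_zpowers _)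
          (Subgroup.mem_zpowers _)).symm
      · exact hres ⟨H, hH⟩ ▸ hF ⟨H, hH⟩
    exact ⟨⟨φ, hφ.mem_repRing⟩, funext hres⟩
  · rintro _ ⟨x, rfl⟩
    exact ⟨fun H => repRing_restrict x.2 H.val,
      fun H K g h hh hk => (repRing_conj x.2 g h).symm⟩
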